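/- The PR-box conditional distributions, defined by P(a,b|x,y) = 1/2 if a ⊕ b = x·y and P(a,b|x,y) = 0 otherwise (for a,b,x,y ∈ {0,1}), are not compatible with the Bell scenario. -/

import Mathlib

open scoped BigOperators NNReal

/-- Compatibility of a family of conditional distributions `P a b x y = P(a,b|x,y)` on
`{0,1}²`, indexed by settings `x, y ∈ {0,1}`, with the Bell causal scenario: there is a
latent variable `Λ` with a probability mass function `μ` and local response functions
`pA`, `pB` reproducing `P`. -/
def BellCompatible (P : Fin 2 → Fin 2 → Fin 2 → Fin 2 → ℝ) : Prop :=
  ∃ (Λ : Type) (μ : Λ → ℝ≥0) (pA : Fin 2 × Λ → Fin 2 → ℝ≥0) (pB : Fin 2 × Λ → Fin 2 → ℝ≥0),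
    (∑' l, μ l) = 1 ∧
    (∀ xl, ∑ a, pA xl a = 1) ∧
    (∀ yl, ∑ b, pB yl b = 1) ∧
    ∀ a b x y, P a b x y = ((∑' l, μ l * pA (x, l) a * pB (y, l) b : ℝ≥0) : ℝ)

/-- If a Bell model assigns probability zero to an event, then that event has probability zero
given each latent value. -/
theorem mul_response_eq_zero_of_tsum_eq_zero {Λ : Type*} {μ p q : Λ → ℝ≥0} (hμ : Summable μ)
    (hp : ∀ l, p l ≤ 1) (hq : ∀ l, q l ≤ 1) (h : ∑' l, μ l * p l * q l = 0) (l : Λ) :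
    μ l * p l * q l = 0 := by
  have hs : Summable fun l => μ l * p l * q l := NNReal.summable_of_le
    (fun l => (mul_le_of_le_one_right' (hq l)).trans (mul_le_of_le_one_right' (hp l))) hμ
  exact (hs.tsum_eq_zero_iff).1 h l

theorem le_one_of_sum_eq_one {ι : Type*} [Fintype ι] {p : ι → ℝ≥0} (h : ∑ i, p i = 1) (i : ι) :
    p i ≤ 1 :=
  h ▸ Finset.single_le_sum (fun _ _ => zero_le) (Finset.mem_univ i)

theorem exists_ne_zero_of_sum_eq_one {ι : Type*} [Fintype ι] {p : ι → ℝ≥0} (h : ∑ i, p i = 1) :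
    ∃ i, p i ≠ 0 := by
  by_contra! h0
  simp [h0] at h

/-- No deterministic local strategy wins the CHSH game with certainty. -/
theorem not_forall_add_eq_mul (f g : Fin 2 → Fin 2) : ¬ ∀ x y, f x + g y = x * y := by
  revert f g
  decide

/-- The PR-box conditional distributions (`P(a,b|x,y) = 1/2` if `a ⊕ b = x·y`, else `0`)
are not compatible with the Bell scenario.  Here addition and multiplication in `Fin 2`
are modulo 2. -/
theorem pr_box_not_bell_compatible :
    ¬ BellCompatible (fun a b x y => if a + b = x * y then (1 : ℝ) / 2 else 0) := by
  rintro ⟨Λ, μ, pA, pB, hμ, hA, hB, hP⟩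
  have hs : Summable μ := by
    by_contra h
    simp [tsum_eq_zero_of_not_summable h] at hμ
  obtain ⟨l, hl⟩ : ∃ l, μ l ≠ 0 := by
    by_contra! h
    simp [h] at hμ
  choose f hf using fun x => exists_ne_zero_of_sum_eq_one (hA (x, l))
  choose g hg using fun y => exists_ne_zero_of_sum_eq_one (hB (y, l))
  refine not_forall_add_eq_mul f g fun x y => ?_
  by_contra hxy
  have h := hP (f x) (g y) x y
  beta_reduce at h
  rw [if_neg hxy, eq_comm, NNReal.coe_eq_zero] at h
  exact mul_ne_zero (mul_ne_zero hl (hf x)) (hg y) <|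
    mul_response_eq_zero_of_tsum_eq_zero hs (fun l => le_one_of_sum_eq_one (hA (x, l)) (f x))
      (fun l => le_one_of_sum_eq_one (hB (y, l)) (g y)) h l
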